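/- arXiv:math/0607458 — 2 statements merged into one kernel-verified Lean document; each statement's English description precedes it below -/
import Mathlib

section
/- Let 1 < p₁, p₂, r < ∞ with 1/r = 1/p₁ + 1/p₂ < 1, and let 1 ≤ q₁, q₂, s ≤ ∞ with 1/q₁ + 1/q₂ ≥ 1/s. If f ∈ L^{p₁,q₁}(ℝⁿ) and g ∈ L^{p₂,q₂}(ℝⁿ), then the pointwise product h = f·g belongs to the Lorentz space L^{r,s}(ℝⁿ) and ‖h‖_{L^{r,s}} ≤ r' ‖f‖_{L^{p₁,q₁}} ‖g‖_{L^{p₂,q₂}}, where r' is the conjugate exponent of r. -/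
open MeasureTheory ENNReal Real Filter
open scoped FourierTransform RealInnerProductSpace Topology

noncomputable section

namespace MHD

attribute [local instance 10] Classical.propDecidable

abbrev V (n : ℕ) := EuclideanSpace ℝ (Fin n)

/-- The distribution function of `f`. -/
def distFn {α F : Type*} [MeasurableSpace α] [NormedAddCommGroup F]
    (μ : Measure α) (f : α → F) (lam : ℝ≥0∞) : ℝ≥0∞ :=
  μ {x | lam < ENNReal.ofReal ‖f x‖}

/-- The decreasing rearrangement of `f`. -/
def rearr {α F : Type*} [MeasurableSpace α] [NormedAddCommGroup F]
    (μ : Measure α) (f : α → F) (t : ℝ≥0∞) : ℝ≥0∞ :=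
  sInf {lam | distFn μ f lam ≤ t}

/-- The Lorentz quasinorm `L^{p,q}` (`p` a finite real exponent, `q ∈ [1,∞]`),
defined via the decreasing rearrangement. -/
def lorentzNorm {α F : Type*} [MeasurableSpace α] [NormedAddCommGroup F]
    (μ : Measure α) (p : ℝ) (q : ℝ≥0∞) (f : α → F) : ℝ≥0∞ :=
  if q = ∞ then ⨆ t : {t : ℝ // 0 < t},
      ENNReal.ofReal ((t : ℝ) ^ (1/p)) * rearr μ f (ENNReal.ofReal t)
  else (∫⁻ t in Set.Ioi (0:ℝ),
      (ENNReal.ofReal (t ^ (1/p)) * rearr μ f (ENNReal.ofReal t)) ^ q.toReal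
        / ENNReal.ofReal t) ^ (1 / q.toReal)

/-- Convolution of two complex valued functions on `ℝⁿ`. -/
def conv {n : ℕ} (f g : V n → ℂ) (x : V n) : ℂ := ∫ y, f y * g (x - y)

/-- `ℓ^r` norm over `ℤ` with values in `ℝ≥0∞`. -/
def lr (r : ℝ≥0∞) (a : ℤ → ℝ≥0∞) : ℝ≥0∞ :=
  if r = ∞ then ⨆ j, a j else (∑' j, a j ^ r.toReal) ^ (1 / r.toReal)

/-- Lebesgue norm in time of an `ℝ≥0∞`-valued function over a time set `I`. -/
def tnorm (ρ : ℝ≥0∞) (I : Set ℝ) (F : ℝ → ℝ≥0∞) : ℝ≥0∞ :=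
  if ρ = ∞ then ⨆ t ∈ I, F t
  else (∫⁻ t in I, F t ^ ρ.toReal) ^ (1 / ρ.toReal)

/-- Partial derivative in the `i`-th coordinate direction. -/
def pd {n : ℕ} {E : Type*} [NormedAddCommGroup E] [NormedSpace ℝ E]
    (i : Fin n) (f : V n → E) (x : V n) : E :=
  fderiv ℝ f x (EuclideanSpace.single i 1)

/-- The Laplacian. -/
def lap {n : ℕ} {E : Type*} [NormedAddCommGroup E] [NormedSpace ℝ E]
    (f : V n → E) (x : V n) : E :=
  ∑ i, pd i (fun y => pd i f y) x

/-- Littlewood-Paley frequency localization operator `Δ_j` associated with the bump `φ`. -/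
def LP {n : ℕ} (φ : V n → ℝ) (j : ℤ) (f : V n → ℂ) : V n → ℂ :=
  𝓕⁻ fun ξ => ((φ ((2:ℝ) ^ (-j) • ξ) : ℝ) : ℂ) * 𝓕 f ξ

/-- Low-frequency cut-off `S_j = ∑_{k ≤ j-1} Δ_k`. -/
def LPlow {n : ℕ} (φ : V n → ℝ) (j : ℤ) (f : V n → ℂ) : V n → ℂ :=
  fun x => ∑' k : {k : ℤ // k < j}, LP φ (k : ℤ) f x

/-- A standard Littlewood-Paley bump function: smooth, nonnegative, supported in the
annulus `{3/4 ≤ |ξ| ≤ 8/3}`, whose dyadic dilates form a partition of unity away from `0`. -/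
structure IsLPFamily {n : ℕ} (φ : V n → ℝ) : Prop where
  smooth : ContDiff ℝ (⊤ : ℕ∞) φ
  nonneg : ∀ ξ, 0 ≤ φ ξ
  support : ∀ ξ : V n, φ ξ ≠ 0 → 3/4 ≤ ‖ξ‖ ∧ ‖ξ‖ ≤ 8/3
  sum_one : ∀ ξ : V n, ξ ≠ 0 → HasSum (fun j : ℤ => φ ((2:ℝ) ^ (-j) • ξ)) 1

/-- Homogeneous Besov norm `Ḃ^s_{p,r}` defined by the Littlewood-Paley decomposition. -/
def besovNorm {n : ℕ} (φ : V n → ℝ) (s : ℝ) (p r : ℝ≥0∞) (f : V n → ℂ) : ℝ≥0∞ :=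
  lr r fun j => ENNReal.ofReal ((2:ℝ) ^ (s * (j:ℝ))) * eLpNorm (LP φ j f) p volume

/-- Chemin-Lerner mixed time-space Besov norm `L̃^ρ(I; Ḃ^s_{p,r})`. -/
def clNorm {n : ℕ} (φ : V n → ℝ) (ρ : ℝ≥0∞) (I : Set ℝ) (s : ℝ) (p r : ℝ≥0∞)
    (u : ℝ → V n → ℂ) : ℝ≥0∞ :=
  lr r fun j => ENNReal.ofReal ((2:ℝ) ^ (s * (j:ℝ))) *
    tnorm ρ I fun t => eLpNorm (LP φ j (u t)) p volume

/-- The complexification of the `i`-th component of a real vector field. -/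
def cplx {n : ℕ} (a : V n → Fin n → ℝ) (i : Fin n) : V n → ℂ := fun x => (a x i : ℂ)

/-- Besov norm of a real vector field (sum of the norms of the components). -/
def besovNormV {n : ℕ} (φ : V n → ℝ) (s : ℝ) (p r : ℝ≥0∞) (a : V n → Fin n → ℝ) : ℝ≥0∞ :=
  ∑ i, besovNorm φ s p r (cplx a i)

/-- Chemin-Lerner norm of a time dependent real vector field. -/
def clNormV {n : ℕ} (φ : V n → ℝ) (ρ : ℝ≥0∞) (I : Set ℝ) (s : ℝ) (p r : ℝ≥0∞)
    (u : ℝ → V n → Fin n → ℝ) : ℝ≥0∞ :=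
  ∑ i, clNorm φ ρ I s p r fun t => cplx (u t) i

/-- Continuity in time with values in the Besov space, expressed through the norm. -/
def ContBesov {n : ℕ} (φ : V n → ℝ) (I : Set ℝ) (s : ℝ) (p r : ℝ≥0∞)
    (u : ℝ → V n → Fin n → ℝ) : Prop :=
  ∀ t₀ ∈ I, Tendsto (fun t => besovNormV φ s p r fun x i => u t x i - u t₀ x i)
    (nhdsWithin t₀ I) (nhds 0)

/-- Divergence-free vector field. -/
def divFree {n : ℕ} (a : V n → Fin n → ℝ) : Prop :=
  ∀ x, ∑ j, pd j (fun y => a y j) x = 0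

/-- Squared Euclidean norm of a vector. -/
def sq {n : ℕ} (v : Fin n → ℝ) : ℝ := ∑ i, (v i) ^ 2

/-- Euclidean dot product. -/
def dotF {n : ℕ} (v w : Fin n → ℝ) : ℝ := ∑ i, v i * w i

/-- Squared Euclidean norm of the full spatial gradient of a vector field. -/
def gradSq {n : ℕ} (a : V n → Fin n → ℝ) (x : V n) : ℝ :=
  ∑ i, ∑ k, (pd k (fun y => a y i) x) ^ 2

/-- The advective derivative `(a·∇)b`. -/
def advect {n : ℕ} (a b : V n → Fin n → ℝ) (x : V n) : Fin n → ℝ :=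
  fun i => ∑ k, a x k * pd k (fun y => b y i) x

/-- Divergence of the tensor product: `(∇·(a⊗b))_i = ∑_j ∂_j (a_j b_i)`. -/
def divT {n : ℕ} (a b : V n → Fin n → ℝ) (x : V n) : Fin n → ℝ :=
  fun i => ∑ j, pd j (fun y => a y j * b y i) x

/-- The Leray projector onto divergence free vector fields, as a Fourier multiplier. -/
def leray {n : ℕ} (F : V n → Fin n → ℝ) : V n → Fin n → ℝ := fun x i =>
  (𝓕⁻ (fun ξ : V n => 𝓕 (cplx F i) ξ -
      (if ξ = 0 then 0 else ((ξ i : ℝ) : ℂ) *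
        (∑ j, ((ξ j : ℝ) : ℂ) * 𝓕 (cplx F j) ξ) / ((‖ξ‖ ^ 2 : ℝ) : ℂ))) x).re

/-- The heat kernel on `ℝⁿ`. -/
def heatKernel {n : ℕ} (t : ℝ) (x : V n) : ℝ :=
  (4 * π * t) ^ (-(n:ℝ)/2) * Real.exp (-‖x‖ ^ 2 / (4 * t))

/-- The heat semigroup `e^{tΔ}` acting on scalar functions (the identity for `t ≤ 0`). -/
def heat {n : ℕ} (t : ℝ) (f : V n → ℝ) : V n → ℝ :=
  if t ≤ 0 then f else fun x => ∫ y, heatKernel t (x - y) * f y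

/-- Mild (integral) formulation of the incompressible MHD system on the time set `I`. -/
def IsMildMHD {n : ℕ} (I : Set ℝ) (u₀ b₀ : V n → Fin n → ℝ)
    (u b : ℝ → V n → Fin n → ℝ) : Prop :=
  (∀ t ∈ I, ∀ x, ∀ i, u t x i = heat t (fun y => u₀ y i) x -
      ∫ s in Set.Ioc 0 t, heat (t - s)
        (fun y => leray (divT (u s) (u s)) y i - leray (divT (b s) (b s)) y i) x) ∧
  (∀ t ∈ I, ∀ x, ∀ i, b t x i = heat t (fun y => b₀ y i) x -
      ∫ s in Set.Ioc 0 t, heat (t - s)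
        (fun y => leray (divT (u s) (b s)) y i - leray (divT (b s) (u s)) y i) x)

/-- Weak (distributional) formulation of the MHD system against smooth, compactly supported,
divergence-free test fields (the pressure disappears). -/
def IsWeakMHD {n : ℕ} (u₀ b₀ : V n → Fin n → ℝ) (u b : ℝ → V n → Fin n → ℝ) : Prop :=
  u 0 = u₀ ∧ b 0 = b₀ ∧ (∀ t, 0 ≤ t → divFree (u t) ∧ divFree (b t)) ∧
  ∀ ψ : ℝ → V n → Fin n → ℝ,
    ContDiff ℝ (⊤ : ℕ∞) (fun z : ℝ × V n => ψ z.1 z.2) →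
    HasCompactSupport (fun z : ℝ × V n => ψ z.1 z.2) →
    (∀ t, divFree (ψ t)) →
    ∀ t, 0 ≤ t →
      (((∫ x, dotF (u t x) (ψ t x)) - ∫ x, dotF (u₀ x) (ψ 0 x))
        = ∫ s in Set.Ioc 0 t, ∫ x,
            (dotF (u s x) (fun i => deriv (fun τ => ψ τ x i) s)
              + dotF (u s x) (fun i => lap (fun y => ψ s y i) x)
              + ∑ i, ∑ j, (u s x j * u s x i - b s x j * b s x i)
                  * pd j (fun y => ψ s y i) x)) ∧
      (((∫ x, dotF (b t x) (ψ t x)) - ∫ x, dotF (b₀ x) (ψ 0 x))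
        = ∫ s in Set.Ioc 0 t, ∫ x,
            (dotF (b s x) (fun i => deriv (fun τ => ψ τ x i) s)
              + dotF (b s x) (fun i => lap (fun y => ψ s y i) x)
              + ∑ i, ∑ j, (u s x j * b s x i - b s x j * u s x i)
                  * pd j (fun y => ψ s y i) x))

/-- The Leray energy inequality. -/
def EnergyIneq {n : ℕ} (u₀ b₀ : V n → Fin n → ℝ) (u b : ℝ → V n → Fin n → ℝ) : Prop :=
  ∀ t, 0 ≤ t →
    (∫⁻ x, ENNReal.ofReal (sq (u t x) + sq (b t x)))
      + 2 * ∫⁻ s in Set.Ioc 0 t, ∫⁻ x, ENNReal.ofReal (gradSq (u s) x + gradSq (b s) x)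
    ≤ ∫⁻ x, ENNReal.ofReal (sq (u₀ x) + sq (b₀ x))

/-- A Leray weak solution: an `L²` weak solution satisfying the energy inequality. -/
def IsLerayWeak {n : ℕ} (u₀ b₀ : V n → Fin n → ℝ) (u b : ℝ → V n → Fin n → ℝ) : Prop :=
  IsWeakMHD u₀ b₀ u b ∧ EnergyIneq u₀ b₀ u b ∧
  (⨆ t ∈ Set.Ici (0:ℝ), ∫⁻ x, ENNReal.ofReal (sq (u t x) + sq (b t x))) < ∞ ∧
  (∫⁻ s in Set.Ioi (0:ℝ), ∫⁻ x, ENNReal.ofReal (gradSq (u s) x + gradSq (b s) x)) < ∞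


/-- Bony paraproduct `T_u v = ∑_j S_{j-1}u Δ_j v`. -/
def paraP {n : ℕ} (φ : V n → ℝ) (u v : V n → ℂ) (x : V n) : ℂ :=
  ∑' j : ℤ, LPlow φ (j - 1) u x * LP φ j v x

/-- Bony remainder `R(u,v) = ∑_{|i-j|≤1} Δ_i u Δ_j v`. -/
def remP {n : ℕ} (φ : V n → ℝ) (u v : V n → ℂ) (x : V n) : ℂ :=
  ∑' j : ℤ, (LP φ (j - 1) u x + LP φ j u x + LP φ (j + 1) u x) * LP φ j v x


/-- The multiplicative Haar measure `dt/t` on `(0,∞)`. -/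
def nu0 : Measure ℝ := (volume.restrict (Set.Ioi (0:ℝ))).withDensity (fun t => (ENNReal.ofReal t)⁻¹)

lemma nu0_lintegral {A : ℝ → ℝ≥0∞} (hA : Measurable A) :
    ∫⁻ t, A t ∂nu0 = ∫⁻ t in Set.Ioi (0:ℝ), A t / ENNReal.ofReal t := by
  unfold nu0
  rw [lintegral_withDensity_eq_lintegral_mul _ (by fun_prop) hA]
  refine lintegral_congr fun t => ?_
  simp [div_eq_mul_inv, mul_comm]

instance : SFinite nu0 := by unfold nu0; infer_instance

lemma nu0_ae_pos : ∀ᵐ t ∂nu0, 0 < t := by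
  unfold nu0
  refine (withDensity_absolutelyContinuous _ _).ae_le ?_
  exact ae_restrict_mem measurableSet_Ioi

lemma nu0_scale {A : ℝ → ℝ≥0∞} (hA : Measurable A) {u : ℝ} (hu : 0 < u) :
    ∫⁻ t, A (u * t) ∂nu0 = ∫⁻ t, A t ∂nu0 := by
  rw [nu0_lintegral (A := fun t => A (u * t)) (by fun_prop), nu0_lintegral hA]
  have himg : (fun x : ℝ => u * x) '' Set.Ioi 0 = Set.Ioi 0 := by
    ext x
    constructor
    · rintro ⟨y, hy, rfl⟩
      exact mul_pos hu hy
    · intro hx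
      exact ⟨x / u, div_pos hx hu, mul_div_cancel₀ x hu.ne'⟩
  have := lintegral_image_eq_lintegral_abs_deriv_mul (s := Set.Ioi (0:ℝ)) (f := fun x => u * x)
    (f' := fun _ => u) measurableSet_Ioi
    (fun x _ => by simpa using ((hasDerivAt_id x).const_mul u).hasDerivWithinAt)
    (fun x _ y _ h => mul_left_cancel₀ hu.ne' h) (fun t => A t / ENNReal.ofReal t)
  rw [himg] at this
  rw [this]
  refine setLIntegral_congr_fun measurableSet_Ioi fun t ht => ?_
  have ht : 0 < t := ht
  simp only [abs_of_pos hu]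
  rw [ENNReal.ofReal_mul hu.le, div_eq_mul_inv, div_eq_mul_inv,
    ENNReal.mul_inv (Or.inr ENNReal.ofReal_ne_top) (Or.inl ENNReal.ofReal_ne_top)]
  rw [mul_left_comm, ← mul_assoc (ENNReal.ofReal u), ENNReal.mul_inv_cancel
    (by simpa using hu) ENNReal.ofReal_ne_top, one_mul]

lemma lint_rpow {a c : ℝ} (ha : -1 < a) (hc : 0 ≤ c) :
    ∫⁻ u in Set.Ioo (0:ℝ) c, ENNReal.ofReal (u ^ a) = ENNReal.ofReal (c ^ (a+1) / (a+1)) := by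
  rw [restrict_Ioo_eq_restrict_Ioc, ← ofReal_integral_eq_lintegral_ofReal,
    ← intervalIntegral.integral_of_le hc, integral_rpow (Or.inl ha)]
  · rw [Real.zero_rpow (by linarith), sub_zero]
  · have := intervalIntegral.intervalIntegrable_rpow' (a := 0) (b := c) ha
    exact (intervalIntegrable_iff_integrableOn_Ioc_of_le hc).1 this
  · filter_upwards [ae_restrict_mem measurableSet_Ioc] with u hu
    exact Real.rpow_nonneg hu.1.le _

lemma antitone_bound {φ : ℝ → ℝ≥0∞} (hφ : Antitone φ) {p q t : ℝ} (hp : 0 < p) (hq : 0 < q)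
    (ht : 0 < t) :
    (ENNReal.ofReal (t ^ (1/p)) * φ t) ^ q * ENNReal.ofReal (p/q) ≤
      ∫⁻ x, (ENNReal.ofReal (x ^ (1/p)) * φ x) ^ q ∂nu0 := by
  have hm : Measurable φ := hφ.measurable
  rw [nu0_lintegral (by fun_prop)]
  calc _ = φ t ^ q * ENNReal.ofReal (t ^ ((q/p-1)+1) / ((q/p-1)+1)) := by
        rw [ENNReal.mul_rpow_of_nonneg _ _ hq.le, ENNReal.ofReal_rpow_of_pos (by positivity),
          mul_comm (ENNReal.ofReal _) (φ t ^ q), mul_assoc,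
          ← ENNReal.ofReal_mul (by positivity)]
        congr 2
        rw [← Real.rpow_mul ht.le, sub_add_cancel, one_div_mul_eq_div]
        field_simp
    _ = ∫⁻ x in Set.Ioo 0 t, φ t ^ q * ENNReal.ofReal (x ^ (q/p-1)) := by
        rw [lintegral_const_mul _ (by fun_prop), lint_rpow _ ht.le]
        have : 0 < q / p := by positivity
        linarith
    _ ≤ ∫⁻ x in Set.Ioo 0 t, (ENNReal.ofReal (x ^ (1/p)) * φ x) ^ q / ENNReal.ofReal x := by
        refine setLIntegral_mono' measurableSet_Ioo fun x hx => ?_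
        have hx0 : 0 < x := hx.1
        rw [ENNReal.mul_rpow_of_nonneg _ _ hq.le, ENNReal.ofReal_rpow_of_pos (by positivity),
          mul_comm (ENNReal.ofReal _) (φ x ^ q), mul_div_assoc, ← ENNReal.ofReal_div_of_pos hx0,
          ← Real.rpow_mul hx0.le, one_div_mul_eq_div, Real.rpow_sub_one hx0.ne']
        gcongr
        exact hφ hx.2.le
    _ ≤ _ := lintegral_mono_set (fun x hx => hx.1)

section rearrangement
variable {α : Type*} [MeasurableSpace α] {μ : Measure α}

lemma rearr_antitone (f : α → ℂ) : Antitone (fun t : ℝ => rearr μ f (ENNReal.ofReal t)) := by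
  intro a b hab
  exact sInf_le_sInf fun l hl => le_trans hl (ENNReal.ofReal_le_ofReal hab)

lemma dist_le_of_lt {f : α → ℂ} {a t : ℝ≥0∞} (h : rearr μ f t < a) : distFn μ f a ≤ t := by
  obtain ⟨l, hl, hla⟩ := sInf_lt_iff.1 h
  refine le_trans (measure_mono fun x hx => ?_) hl
  exact lt_trans hla hx

lemma rearr_mul_le {f g : α → ℂ} {t u : ℝ≥0∞} (hf : rearr μ f t ≠ ∞) (hg : rearr μ g u ≠ ∞) :
    rearr μ (fun x => f x * g x) (t + u) ≤ rearr μ f t * rearr μ g u := by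
  refine ENNReal.le_mul_of_forall_lt (Or.inr hg) (Or.inl hf) fun a ha b hb => ?_
  refine sInf_le ?_
  refine le_trans (le_trans (measure_mono (fun x hx => ?_)) (measure_union_le _ _))
    (add_le_add (dist_le_of_lt ha) (dist_le_of_lt hb))
  by_contra hcon
  simp only [Set.mem_union, Set.mem_ofPred_eq, not_or, not_lt] at hcon hx
  rw [norm_mul, ENNReal.ofReal_mul (norm_nonneg _)] at hx
  exact absurd (mul_le_mul' hcon.1 hcon.2) (not_le.2 hx)

end rearrangement

lemma two_rearr {a b c d : ℝ≥0∞} (h1 : a ≤ b) (h2 : c ≤ d) :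
    a * d + b * c ≤ a * c + b * d := by
  obtain ⟨x, rfl⟩ := exists_add_of_le h1
  obtain ⟨y, rfl⟩ := exists_add_of_le h2
  have : a * c + (a + x) * (c + y) = a * (c + y) + (a + x) * c + x * y := by ring
  rw [this]; exact le_self_add

/-- `h*(t) ≤ ∫₀¹ f*(ut) g*(ut) du`. -/
lemma avg_bound {F G : ℝ → ℝ≥0∞} (hF : Antitone F) (hG : Antitone G) {t : ℝ} (ht : 0 < t)
    {H : ℝ≥0∞} (hH : ∀ u v, 0 < u → 0 < v → u + v = t → H ≤ F u * G v) :
    H ≤ ∫⁻ u in Set.Ioo (0:ℝ) 1, F (u * t) * G (u * t) := by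
  have hFm : Measurable F := hF.measurable
  have hGm : Measurable G := hG.measurable
  have hrefl : ∫⁻ u in Set.Ioo (0:ℝ) 1, F ((1-u) * t) * G ((1-u) * t) =
      ∫⁻ u in Set.Ioo (0:ℝ) 1, F (u * t) * G (u * t) := by
    have himg : (fun x : ℝ => 1 - x) '' Set.Ioo 0 1 = Set.Ioo 0 1 := by
      simp
    have := lintegral_image_eq_lintegral_abs_deriv_mul (s := Set.Ioo (0:ℝ) 1)
      (f := fun x => 1 - x)
      (f' := fun _ => -1) measurableSet_Ioo
      (fun x _ => by simpa using ((hasDerivAt_id x).const_sub 1).hasDerivWithinAt)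
      (fun x _ y _ h => by simpa using h) (fun u => F (u * t) * G (u * t))
    rw [himg] at this
    rw [this]; simp
  have h2 : 2 * H ≤ 2 * ∫⁻ u in Set.Ioo (0:ℝ) 1, F (u * t) * G (u * t) := by
    calc 2 * H = ∫⁻ u in Set.Ioo (0:ℝ) 1, 2 * H := by simp
      _ ≤ ∫⁻ u in Set.Ioo (0:ℝ) 1, (F (u * t) * G (u * t) + F ((1-u) * t) * G ((1-u) * t)) := by
        refine setLIntegral_mono' measurableSet_Ioo fun u hu => ?_
        have hu0 := hu.1
        have hu1 : 0 < 1 - u := sub_pos.2 hu.2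
        have e1 := hH (u*t) ((1-u)*t) (by positivity) (by positivity) (by ring)
        have e2 := hH ((1-u)*t) (u*t) (by positivity) (by positivity) (by ring)
        rw [two_mul]
        refine (add_le_add e1 e2).trans ?_
        rcases le_total (u*t) ((1-u)*t) with h | h
        · have := two_rearr (hF h) (hG h)
          calc _ = F ((1-u)*t) * G (u*t) + F (u*t) * G ((1-u)*t) := add_comm _ _
            _ ≤ _ := this
            _ = _ := add_comm _ _
        · exact two_rearr (hF h) (hG h)
      _ = _ := by rw [lintegral_add_left (by fun_prop), hrefl, two_mul]
  exact (ENNReal.mul_le_mul_iff_right (by simp) (by simp)).1 h2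

lemma jensen_rpow {α : Type*} [MeasurableSpace α] (μ : Measure α) {A : α → ℝ≥0∞}
    (hA : Measurable A) {w : ℝ} (hw : 1 ≤ w) :
    (∫⁻ x, A x ∂μ) ^ w ≤ (μ Set.univ) ^ (w - 1) * ∫⁻ x, A x ^ w ∂μ := by
  rcases hw.eq_or_lt with rfl | hw
  · simp
  have hw0 : 0 < w := by linarith
  have hc : w.HolderConjugate (w.conjExponent) := Real.HolderConjugate.conjExponent hw
  have h := ENNReal.lintegral_mul_le_Lp_mul_Lq μ hc (f := A) (g := fun _ => 1)
    hA.aemeasurable aemeasurable_const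
  simp only [Pi.mul_apply, mul_one, ENNReal.one_rpow, lintegral_const, one_mul] at h
  have h2 := ENNReal.rpow_le_rpow h hw0.le
  refine h2.trans (le_of_eq ?_)
  rw [ENNReal.mul_rpow_of_nonneg _ _ hw0.le, ← ENNReal.rpow_mul, ← ENNReal.rpow_mul,
    one_div_mul_cancel hw0.ne', ENNReal.rpow_one, mul_comm]
  congr 2
  rw [Real.conjExponent]
  have : w - 1 ≠ 0 := by linarith
  field_simp

/-- The measure `u^{-1/r} du` on `(0,1)`. -/
def nu1 (r : ℝ) : Measure ℝ :=
  (volume.restrict (Set.Ioo (0:ℝ) 1)).withDensity (fun u => ENNReal.ofReal (u ^ (-(1/r))))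

instance (r : ℝ) : SFinite (nu1 r) := by unfold nu1; infer_instance

lemma nu1_lintegral (r : ℝ) {A : ℝ → ℝ≥0∞} (hA : Measurable A) :
    ∫⁻ t, A t ∂(nu1 r) = ∫⁻ u in Set.Ioo (0:ℝ) 1, ENNReal.ofReal (u ^ (-(1/r))) * A u := by
  unfold nu1
  rw [lintegral_withDensity_eq_lintegral_mul _ (by fun_prop) hA]
  rfl

lemma nu1_ae_pos (r : ℝ) : ∀ᵐ t ∂(nu1 r), 0 < t := by
  unfold nu1
  refine (withDensity_absolutelyContinuous _ _).ae_le ?_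
  filter_upwards [ae_restrict_mem measurableSet_Ioo] with x hx using hx.1

lemma nu1_univ {r r' : ℝ} (hr : 1 < r) (hr' : 1/r + 1/r' = 1) :
    nu1 r Set.univ = ENNReal.ofReal r' := by
  have h1 : 1 / r < 1 := by rw [div_lt_one (by linarith)]; exact hr
  have := nu1_lintegral r (A := fun _ => 1) measurable_const
  simp only [lintegral_const, one_mul, mul_one] at this
  rw [this, lint_rpow (by linarith) zero_le_one, Real.one_rpow]
  congr 1
  have : -(1/r) + 1 = 1 / r' := by linarith
  rw [this, one_div_one_div]

lemma nu1_le {r : ℝ} (hr : 1 < r) {A : ℝ → ℝ≥0∞} (hA : Measurable A) :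
    ∫⁻ t, A t ∂(nu1 r) ≤ ∫⁻ t, A t ∂nu0 := by
  rw [nu1_lintegral r hA, nu0_lintegral hA]
  refine le_trans (setLIntegral_mono' measurableSet_Ioo fun u hu => ?_)
    (lintegral_mono_set (fun u hu => hu.1))
  rw [div_eq_mul_inv (A u), mul_comm, ← ENNReal.ofReal_inv_of_pos hu.1]
  gcongr
  rw [← Real.rpow_neg_one]
  refine Real.rpow_le_rpow_of_exponent_ge hu.1 hu.2.le ?_
  have h1 : 1 / r < 1 := by rw [div_lt_one (by linarith)]; exact hr
  linarith

section hardy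
variable {r r' : ℝ} {Φ X : ℝ → ℝ≥0∞}

lemma one_le_r' (hr : 1 < r) (hr' : 1/r + 1/r' = 1) : 1 ≤ r' := by
  have h1 : 1 / r < 1 := by rw [div_lt_one (by linarith)]; exact hr
  have h2 : 0 < 1 / r := by positivity
  have h3 : 0 < 1 / r' := by linarith
  have h4 : 0 < r' := one_div_pos.1 h3
  have h5 : 1 / r' ≤ 1 := by linarith
  rwa [div_le_one h4] at h5

lemma hardy_sup (hr : 1 < r) (hr' : 1/r + 1/r' = 1) (hΦ : Measurable Φ)
    (hX : ∀ t, 0 < t → X t ≤ ∫⁻ u, Φ (u * t) ∂(nu1 r)) {w : ℝ} (hw : 1 ≤ w) {N : ℝ≥0∞}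
    (hN : ∫⁻ t, Φ t ^ w ∂nu0 ≤ N ^ w) {t : ℝ} (ht : 0 < t) :
    X t ≤ ENNReal.ofReal r' * N := by
  have hw0 : 0 < w := by linarith
  have h1 : 1 ≤ ENNReal.ofReal r' := by simpa using one_le_r' hr hr'
  rw [← ENNReal.rpow_le_rpow_iff hw0]
  calc X t ^ w ≤ (∫⁻ u, Φ (u * t) ∂(nu1 r)) ^ w := ENNReal.rpow_le_rpow (hX t ht) hw0.le
    _ ≤ _ := jensen_rpow _ (by fun_prop) hw
    _ ≤ ENNReal.ofReal r' ^ (w - 1) * N ^ w := by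
      rw [nu1_univ hr hr']
      gcongr
      refine (nu1_le hr (by fun_prop)).trans ?_
      simp_rw [mul_comm _ t]
      rw [nu0_scale (A := fun x => Φ x ^ w) (by fun_prop) ht]
      exact hN
    _ ≤ ENNReal.ofReal r' ^ w * N ^ w := by
      gcongr
      linarith
    _ = _ := by rw [ENNReal.mul_rpow_of_nonneg _ _ hw0.le]

lemma hardy_int (hr : 1 < r) (hr' : 1/r + 1/r' = 1) (hΦ : Measurable Φ)
    (hX : ∀ t, 0 < t → X t ≤ ∫⁻ u, Φ (u * t) ∂(nu1 r)) {w : ℝ} (hw : 1 ≤ w) {N : ℝ≥0∞}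
    (hN : ∫⁻ t, Φ t ^ w ∂nu0 ≤ N ^ w) :
    ∫⁻ t, X t ^ w ∂nu0 ≤ (ENNReal.ofReal r' * N) ^ w := by
  have hw0 : 0 < w := by linarith
  have hr0 : 0 < r' := lt_of_lt_of_le one_pos (one_le_r' hr hr')
  calc ∫⁻ t, X t ^ w ∂nu0
      ≤ ∫⁻ t, ENNReal.ofReal r' ^ (w-1) * ∫⁻ u, Φ (u * t) ^ w ∂(nu1 r) ∂nu0 := by
        refine lintegral_mono_ae ?_
        filter_upwards [nu0_ae_pos] with t ht
        rw [← nu1_univ hr hr']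
        exact (ENNReal.rpow_le_rpow (hX t ht) hw0.le).trans (jensen_rpow _ (by fun_prop) hw)
    _ = ENNReal.ofReal r' ^ (w-1) * ∫⁻ u, ∫⁻ t, Φ (u * t) ^ w ∂nu0 ∂(nu1 r) := by
        rw [lintegral_const_mul' _ _ (ENNReal.rpow_ne_top_of_nonneg (by linarith)
          ENNReal.ofReal_ne_top), lintegral_lintegral_swap]
        exact Measurable.aemeasurable (by fun_prop)
    _ = ENNReal.ofReal r' ^ (w-1) * ∫⁻ u, (∫⁻ t, Φ t ^ w ∂nu0) ∂(nu1 r) := by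
        congr 1
        refine lintegral_congr_ae ?_
        filter_upwards [nu1_ae_pos r] with u hu
        exact nu0_scale (A := fun x => Φ x ^ w) (by fun_prop) hu
    _ ≤ ENNReal.ofReal r' ^ (w-1) * (N ^ w * ENNReal.ofReal r') := by
        rw [lintegral_const, nu1_univ hr hr']
        gcongr
    _ = _ := by
        rw [ENNReal.mul_rpow_of_nonneg _ _ hw0.le, mul_comm (N ^ w), ← mul_assoc]
        congr 1
        conv_rhs => rw [← sub_add_cancel w 1]
        rw [ENNReal.rpow_add_of_nonneg _ _ (by linarith) zero_le_one, ENNReal.rpow_one]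

end hardy

lemma interp_bound {X : ℝ → ℝ≥0∞} {K : ℝ≥0∞} {w s : ℝ} (hK : K ≠ ∞) (hw : 0 < w) (hws : w ≤ s)
    (h1 : ∀ t, 0 < t → X t ≤ K) (h2 : ∫⁻ t, X t ^ w ∂nu0 ≤ K ^ w) :
    ∫⁻ t, X t ^ s ∂nu0 ≤ K ^ s := by
  have e : ∀ x : ℝ≥0∞, x ^ s = x ^ (s - w) * x ^ w := fun x => by
    rw [← ENNReal.rpow_add_of_nonneg _ _ (by linarith) hw.le, sub_add_cancel]
  calc ∫⁻ t, X t ^ s ∂nu0 ≤ ∫⁻ t, K ^ (s - w) * X t ^ w ∂nu0 := by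
        refine lintegral_mono_ae ?_
        filter_upwards [nu0_ae_pos] with t ht
        rw [e]
        gcongr
        exact h1 t ht
    _ = K ^ (s - w) * ∫⁻ t, X t ^ w ∂nu0 :=
        lintegral_const_mul' _ _ (ENNReal.rpow_ne_top_of_nonneg (by linarith) hK)
    _ ≤ K ^ (s - w) * K ^ w := by gcongr
    _ = _ := (e K).symm

/-- Auxiliary: `n` bounds the `L^q(dt/t)` norm of `A`. -/
def NB (q : ℝ≥0∞) (A : ℝ → ℝ≥0∞) (n : ℝ≥0∞) : Prop :=
  (q = ∞ → ∀ t, 0 < t → A t ≤ n) ∧ (q ≠ ∞ → ∫⁻ t, A t ^ q.toReal ∂nu0 ≤ n ^ q.toReal)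

lemma NB_holder_top {q : ℝ≥0∞} {A B : ℝ → ℝ≥0∞} {a b : ℝ≥0∞} (ha' : a ≠ ∞)
    (ha : NB ∞ A a) (hb : NB q B b) (hq : q ≠ ∞) :
    ∫⁻ t, (A t * B t) ^ q.toReal ∂nu0 ≤ (a * b) ^ q.toReal := by
  calc _ ≤ ∫⁻ t, a ^ q.toReal * B t ^ q.toReal ∂nu0 := by
        refine lintegral_mono_ae ?_
        filter_upwards [nu0_ae_pos] with t ht
        rw [← ENNReal.mul_rpow_of_nonneg _ _ ENNReal.toReal_nonneg]
        gcongr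
        exact ha.1 rfl t ht
    _ = a ^ q.toReal * ∫⁻ t, B t ^ q.toReal ∂nu0 :=
        lintegral_const_mul' _ _ (ENNReal.rpow_ne_top_of_nonneg ENNReal.toReal_nonneg ha')
    _ ≤ a ^ q.toReal * b ^ q.toReal := by gcongr; exact hb.2 hq
    _ = _ := (ENNReal.mul_rpow_of_nonneg _ _ ENNReal.toReal_nonneg).symm

lemma NB_holder {q₁ q₂ : ℝ≥0∞} {A B : ℝ → ℝ≥0∞} {a b : ℝ≥0∞} (hA : Measurable A)
    (hB : Measurable B) (ha' : a ≠ ∞) (hb' : b ≠ ∞) (h1 : 1 ≤ q₁) (h2 : 1 ≤ q₂)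
    (ha : NB q₁ A a) (hb : NB q₂ B b) {w : ℝ} (hw : 0 < w)
    (hwq : 1 / w = 1 / q₁.toReal + 1 / q₂.toReal) :
    ∫⁻ t, (A t * B t) ^ w ∂nu0 ≤ (a * b) ^ w := by
  by_cases e1 : q₁ = ∞
  · subst e1
    have hw' : w = q₂.toReal := by simpa using hwq
    have e2 : q₂ ≠ ∞ := by rintro rfl; simp at hw'; linarith
    rw [hw']
    exact NB_holder_top ha' ha hb e2
  by_cases e2 : q₂ = ∞
  · subst e2
    have hw' : w = q₁.toReal := by simpa using hwq
    rw [hw', mul_comm a]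
    simp_rw [mul_comm (A _)]
    exact NB_holder_top hb' hb ha e1
  have p1 : 0 < q₁.toReal := ENNReal.toReal_pos (by positivity) e1
  have p2 : 0 < q₂.toReal := ENNReal.toReal_pos (by positivity) e2
  have hlt : w < q₁.toReal := by
    have : 0 < 1 / q₂.toReal := by positivity
    exact (one_div_lt_one_div p1 hw).1 (by linarith)
  have h := ENNReal.lintegral_Lp_mul_le_Lq_mul_Lr hw hlt hwq nu0 hA.aemeasurable hB.aemeasurable
  have h' : (∫⁻ t, (A t * B t) ^ w ∂nu0) ^ (1 / w) ≤ a * b := by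
    refine h.trans (mul_le_mul' ?_ ?_)
    · rw [one_div, ENNReal.rpow_inv_le_iff p1]; exact ha.2 e1
    · rw [one_div, ENNReal.rpow_inv_le_iff p2]; exact hb.2 e2
  rwa [one_div, ENNReal.rpow_inv_le_iff hw] at h'

section lor
variable {α : Type*} [MeasurableSpace α] {μ : Measure α}

lemma rearr_meas (f : α → ℂ) : Measurable (fun t : ℝ => rearr μ f (ENNReal.ofReal t)) :=
  (rearr_antitone f).measurable

lemma lorentz_eq {p : ℝ} {q : ℝ≥0∞} (f : α → ℂ) (hq : q ≠ ∞) :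
    lorentzNorm μ p q f = (∫⁻ t, (ENNReal.ofReal (t ^ (1/p)) *
      rearr μ f (ENNReal.ofReal t)) ^ q.toReal ∂nu0) ^ (1 / q.toReal) := by
  have := rearr_meas (μ := μ) f
  rw [nu0_lintegral (by fun_prop), lorentzNorm, if_neg hq]

lemma lorentz_NB {p : ℝ} {q : ℝ≥0∞} (hq1 : 1 ≤ q) (f : α → ℂ) :
    NB q (fun t => ENNReal.ofReal (t ^ (1/p)) * rearr μ f (ENNReal.ofReal t))
      (lorentzNorm μ p q f) := by
  constructor
  · intro hq t ht
    rw [lorentzNorm, if_pos hq]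
    exact le_iSup (fun t : {t : ℝ // 0 < t} =>
      ENNReal.ofReal ((t : ℝ) ^ (1/p)) * rearr μ f (ENNReal.ofReal t)) ⟨t, ht⟩
  · intro hq
    have p1 : 0 < q.toReal := ENNReal.toReal_pos (by positivity) hq
    rw [lorentz_eq f hq, ← ENNReal.rpow_mul, one_div_mul_cancel p1.ne', ENNReal.rpow_one]

lemma lorentz_le_of_NB {p : ℝ} {q K : ℝ≥0∞} (hq1 : 1 ≤ q) (f : α → ℂ)
    (h : NB q (fun t => ENNReal.ofReal (t ^ (1/p)) * rearr μ f (ENNReal.ofReal t)) K) :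
    lorentzNorm μ p q f ≤ K := by
  by_cases hq : q = ∞
  · rw [lorentzNorm, if_pos hq]
    exact iSup_le fun t => h.1 hq t t.2
  · have p1 : 0 < q.toReal := ENNReal.toReal_pos (by positivity) hq
    rw [lorentz_eq f hq, one_div q.toReal, ENNReal.rpow_inv_le_iff p1]
    exact h.2 hq

lemma rearr_ne_top {p : ℝ} {q : ℝ≥0∞} (hp : 0 < p) (hq1 : 1 ≤ q) (f : α → ℂ)
    (hf : lorentzNorm μ p q f < ∞) {t : ℝ} (ht : 0 < t) :
    rearr μ f (ENNReal.ofReal t) ≠ ∞ := by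
  intro htop
  have hpos : ENNReal.ofReal (t ^ (1/p)) ≠ 0 := by simpa using Real.rpow_pos_of_pos ht _
  have hNB := lorentz_NB (μ := μ) (p := p) hq1 f
  by_cases hq : q = ∞
  · have := hNB.1 hq t ht
    simp only [htop, ENNReal.mul_top hpos, top_le_iff] at this
    exact hf.ne this
  · have p1 : 0 < q.toReal := ENNReal.toReal_pos (by positivity) hq
    have h1 := (antitone_bound (rearr_antitone (μ := μ) f) hp p1 ht).trans (hNB.2 hq)
    have hpq : ENNReal.ofReal (p / q.toReal) ≠ 0 := by
      simp only [ne_eq, ENNReal.ofReal_eq_zero, not_le]; positivity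
    simp only [htop, ENNReal.mul_top hpos, ENNReal.top_rpow_of_pos p1, ENNReal.top_mul hpq,
      top_le_iff] at h1
    exact ENNReal.rpow_ne_top_of_nonneg p1.le hf.ne h1

end lor

/-- O'Neil's generalized Hölder inequality in Lorentz spaces. -/
theorem generalized_holder_lorentz (n : ℕ) (p₁ p₂ r r' : ℝ) (q₁ q₂ s : ℝ≥0∞)
    (hp₁ : 1 < p₁) (hp₂ : 1 < p₂) (hr : 1 < r)
    (hrpp : 1/r = 1/p₁ + 1/p₂) (hlt1 : 1/p₁ + 1/p₂ < 1)
    (hq₁ : 1 ≤ q₁) (hq₂ : 1 ≤ q₂) (hs : 1 ≤ s) (hqs : 1/s ≤ 1/q₁ + 1/q₂)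
    (hr' : 1/r + 1/r' = 1)
    (f g : V n → ℂ)
    (hfm : AEStronglyMeasurable f volume) (hgm : AEStronglyMeasurable g volume)
    (hf : lorentzNorm volume p₁ q₁ f < ∞) (hg : lorentzNorm volume p₂ q₂ g < ∞) :
    lorentzNorm volume r s (fun x => f x * g x) < ∞ ∧
    lorentzNorm volume r s (fun x => f x * g x) ≤
      ENNReal.ofReal r' * (lorentzNorm volume p₁ q₁ f * lorentzNorm volume p₂ q₂ g) := by

  set a := lorentzNorm volume p₁ q₁ f with ha
  set b := lorentzNorm volume p₂ q₂ g with hb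
  have hab : a * b ≠ ∞ := ENNReal.mul_ne_top hf.ne hg.ne
  have hK : ENNReal.ofReal r' * (a * b) ≠ ∞ := ENNReal.mul_ne_top ENNReal.ofReal_ne_top hab
  suffices hmain : lorentzNorm volume r s (fun x => f x * g x) ≤
      ENNReal.ofReal r' * (a * b) from ⟨lt_of_le_of_lt hmain hK.lt_top, hmain⟩
  refine lorentz_le_of_NB hs _ ?_
  have hp₁0 : 0 < p₁ := by linarith
  have hp₂0 : 0 < p₂ := by linarith
  have hr0 : 0 < r := by linarith
  set F : ℝ → ℝ≥0∞ := fun t => rearr volume f (ENNReal.ofReal t) with hF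
  set G : ℝ → ℝ≥0∞ := fun t => rearr volume g (ENNReal.ofReal t) with hG
  have hFa : Antitone F := rearr_antitone f
  have hGa : Antitone G := rearr_antitone g
  have hFm : Measurable F := hFa.measurable
  have hGm : Measurable G := hGa.measurable
  set X : ℝ → ℝ≥0∞ := fun t => ENNReal.ofReal (t ^ (1/r)) *
    rearr volume (fun x => f x * g x) (ENNReal.ofReal t) with hXdef
  set Φ : ℝ → ℝ≥0∞ := fun t => (ENNReal.ofReal (t ^ (1/p₁)) * F t) *
    (ENNReal.ofReal (t ^ (1/p₂)) * G t) with hΦdef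
  have hΦm : Measurable Φ := by rw [hΦdef]; fun_prop
  have hφa : Antitone (fun t => F t * G t) := fun x y h => mul_le_mul' (hFa h) (hGa h)
  have hΦ : ∀ t, 0 < t → Φ t = ENNReal.ofReal (t ^ (1/r)) * (F t * G t) := by
    intro t ht
    rw [hrpp, Real.rpow_add ht, ENNReal.ofReal_mul (by positivity)]
    simp only [hΦdef]; ring
  have hX : ∀ t, 0 < t → X t ≤ ∫⁻ u, Φ (u * t) ∂(nu1 r) := by
    intro t ht
    have h1 := avg_bound hFa hGa ht
      (H := rearr volume (fun x => f x * g x) (ENNReal.ofReal t)) (fun u v hu hv huv => by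
        rw [← huv, ENNReal.ofReal_add hu.le hv.le]
        exact rearr_mul_le (rearr_ne_top hp₁0 hq₁ f hf hu) (rearr_ne_top hp₂0 hq₂ g hg hv))
    rw [nu1_lintegral r (by fun_prop)]
    calc X t ≤ ENNReal.ofReal (t ^ (1/r)) * ∫⁻ u in Set.Ioo (0:ℝ) 1, F (u * t) * G (u * t) := by
          simp only [hXdef]; gcongr
      _ = ∫⁻ u in Set.Ioo (0:ℝ) 1, ENNReal.ofReal (t ^ (1/r)) * (F (u * t) * G (u * t)) :=
          (lintegral_const_mul _ (by fun_prop)).symm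
      _ = _ := by
          refine setLIntegral_congr_fun measurableSet_Ioo fun u hu => ?_
          have hu0 : 0 < u := hu.1
          rw [hΦ _ (mul_pos hu0 ht), ← mul_assoc, ← mul_assoc (ENNReal.ofReal (u ^ (-(1/r)))),
            ← mul_assoc, ← ENNReal.ofReal_mul (by positivity), Real.mul_rpow hu0.le ht.le,
            ← mul_assoc (u ^ (-(1/r))), ← Real.rpow_add hu0, neg_add_cancel, Real.rpow_zero,
            one_mul, mul_assoc]
  have hNf := lorentz_NB (μ := volume) (p := p₁) hq₁ f
  have hNg := lorentz_NB (μ := volume) (p := p₂) hq₂ g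
  by_cases hqq : q₁ = ∞ ∧ q₂ = ∞
  · obtain ⟨rfl, rfl⟩ := hqq
    have hs' : s = ∞ := by simpa using hqs
    subst hs'
    refine ⟨fun _ t ht => (hX t ht).trans ?_, fun h => absurd rfl h⟩
    calc ∫⁻ u, Φ (u * t) ∂(nu1 r) ≤ ∫⁻ u, a * b ∂(nu1 r) := by
          refine lintegral_mono_ae ?_
          filter_upwards [nu1_ae_pos r] with u hu
          exact mul_le_mul' (hNf.1 rfl _ (mul_pos hu ht)) (hNg.1 rfl _ (mul_pos hu ht))
      _ = _ := by rw [lintegral_const, nu1_univ hr hr', mul_comm]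
  -- the main case
  have hs1 : 1 / s.toReal ≤ 1 / q₁.toReal + 1 / q₂.toReal := by
    have hne1 : 1 / q₁ ≠ ∞ := by
      simp only [one_div, ne_eq, ENNReal.inv_eq_top]; rintro rfl; simp at hq₁
    have hne2 : 1 / q₂ ≠ ∞ := by
      simp only [one_div, ne_eq, ENNReal.inv_eq_top]; rintro rfl; simp at hq₂
    have := ENNReal.toReal_mono (ENNReal.add_ne_top.2 ⟨hne1, hne2⟩) hqs
    rw [ENNReal.toReal_add hne1 hne2] at this
    simpa [ENNReal.toReal_div] using this
  have hW : 0 < 1 / q₁.toReal + 1 / q₂.toReal := by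
    rcases not_and_or.1 hqq with h | h
    · have : 0 < q₁.toReal := ENNReal.toReal_pos (by positivity) h
      positivity
    · have : 0 < q₂.toReal := ENNReal.toReal_pos (by positivity) h
      positivity
  obtain ⟨w, hw1, hws, hwN⟩ : ∃ w : ℝ, 1 ≤ w ∧ (s ≠ ∞ → w ≤ s.toReal) ∧
      ∫⁻ t, Φ t ^ w ∂nu0 ≤ (a * b) ^ w := by
    set w := 1 / (1 / q₁.toReal + 1 / q₂.toReal) with hwdef
    have hw0 : 0 < w := by positivity
    have hwN : ∫⁻ t, Φ t ^ w ∂nu0 ≤ (a * b) ^ w :=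
      NB_holder (A := fun t => ENNReal.ofReal (t ^ (1/p₁)) * F t)
        (B := fun t => ENNReal.ofReal (t ^ (1/p₂)) * G t) (by fun_prop) (by fun_prop) hf.ne hg.ne hq₁ hq₂ hNf hNg hw0
        (by rw [hwdef, one_div_one_div])
    rcases le_or_gt 1 w with h | h
    · refine ⟨w, h, fun hsne => ?_, hwN⟩
      have p1 : 0 < s.toReal := ENNReal.toReal_pos (by positivity) hsne
      exact (one_div_le_one_div p1 hw0).1 (by rw [hwdef, one_div_one_div]; exact hs1)
    · refine ⟨1, le_rfl, fun hsne => ?_, ?_⟩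
      · simpa using ENNReal.toReal_mono hsne hs
      · refine interp_bound hab hw0 h.le (fun t ht => ?_) hwN
        have h1 := antitone_bound hφa hr0 hw0 ht
        have h2 : ∫⁻ x, (ENNReal.ofReal (x ^ (1/r)) * (F x * G x)) ^ w ∂nu0 =
            ∫⁻ t, Φ t ^ w ∂nu0 := by
          refine lintegral_congr_ae ?_
          filter_upwards [nu0_ae_pos] with x hx
          rw [hΦ x hx]
        rw [h2] at h1
        have h3 := h1.trans hwN
        rw [← hΦ t ht] at h3
        rw [← ENNReal.rpow_le_rpow_iff hw0]
        refine le_trans ?_ h3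
        refine le_mul_of_one_le_right' ?_
        rw [ENNReal.one_le_ofReal, one_le_div hw0]
        linarith
  have hsup : ∀ t, 0 < t → X t ≤ ENNReal.ofReal r' * (a * b) :=
    fun t ht => hardy_sup hr hr' hΦm hX hw1 hwN ht
  refine ⟨fun _ => hsup, fun hsne => ?_⟩
  exact interp_bound hK (by linarith) (hws hsne) hsup (hardy_int hr hr' hΦm hX hw1 hwN)

end MHD
end
end

section
/- Let 1 < p, q, r < ∞ with 1/r = 1/p + 1/q − 1. If f ∈ L^{p,∞}(ℝⁿ) and g ∈ L^{q,∞}(ℝⁿ) (weak Lebesgue spaces), then f * g ∈ L^{r,∞}(ℝⁿ) and ‖f * g‖_{L^{r,∞}} ≤ C(p,q) ‖f‖_{L^{p,∞}} ‖g‖_{L^{q,∞}} for some constant C(p,q) depending only on p and q. -/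
open MeasureTheory ENNReal Real Filter
open scoped FourierTransform RealInnerProductSpace Topology

noncomputable section

namespace MHD

attribute [local instance 10] Classical.propDecidable

lemma weak_dist {α : Type*} [MeasurableSpace α] (μ : Measure α) (f : α → ℂ) (p A : ℝ)
    (hp : 0 < p) (hA : 0 < A) (h : lorentzNorm μ p ∞ f ≤ ENNReal.ofReal A)
    (l : ℝ) (hl : 0 < l) :
    μ {x | l < ‖f x‖} ≤ ENNReal.ofReal (A ^ p * l ^ (-p)) := by
  refine ENNReal.le_of_forall_pos_le_add fun ε hε _ => ?_
  set s : ℝ := A ^ p * l ^ (-p) with hs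
  have hs0 : 0 < s := by positivity
  have hε' : (0:ℝ) < ε := by exact_mod_cast hε
  have ht : 0 < s + ε := by positivity
  have e : ENNReal.ofReal s + ε = ENNReal.ofReal (s + ε) := by
    rw [ENNReal.ofReal_add hs0.le hε'.le, ENNReal.ofReal_coe_nnreal]
  rw [e]
  have h1 : ENNReal.ofReal ((s+ε) ^ (1/p)) * rearr μ f (ENNReal.ofReal (s+ε))
      ≤ ENNReal.ofReal A := by
    refine le_trans ?_ h
    rw [lorentzNorm, if_pos rfl]
    exact le_iSup (fun t : {t : ℝ // 0 < t} =>
      ENNReal.ofReal ((t : ℝ) ^ (1/p)) * rearr μ f (ENNReal.ofReal t)) ⟨s+ε, ht⟩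
  have hpos : 0 < (s+ε) ^ (1/p) := by positivity
  have hlt : A < (s+ε) ^ (1/p) * l := by
    have h2 : s ^ (1/p) < (s+ε) ^ (1/p) :=
      Real.rpow_lt_rpow hs0.le (by linarith) (by positivity)
    have h3 : s ^ (1/p) = A * l⁻¹ := by
      rw [hs, Real.mul_rpow (by positivity) (by positivity), ← Real.rpow_mul hA.le,
        ← Real.rpow_mul hl.le]
      rw [show p * (1/p) = 1 by field_simp, show -p * (1/p) = -1 by field_simp,
        Real.rpow_one, Real.rpow_neg_one]
    rw [h3] at h2
    calc A = A * l⁻¹ * l := by field_simp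
      _ < _ := by gcongr
  have h4 : rearr μ f (ENNReal.ofReal (s+ε)) < ENNReal.ofReal l := by
    by_contra hcon
    push Not at hcon
    have : ENNReal.ofReal ((s+ε) ^ (1/p)) * ENNReal.ofReal l ≤ ENNReal.ofReal A :=
      le_trans (by gcongr) h1
    rw [← ENNReal.ofReal_mul hpos.le, ENNReal.ofReal_le_ofReal_iff hA.le] at this
    linarith
  rw [rearr, sInf_lt_iff] at h4
  obtain ⟨l', hl', hll⟩ := h4
  refine le_trans (measure_mono ?_) hl'
  intro x hx
  simp only [Set.mem_ofPred_eq] at hx ⊢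
  exact hll.trans_le (ENNReal.ofReal_le_ofReal hx.le)

def hiPart (M s : ℝ) : ℝ := if M < s then s else 0
def loPart (M s : ℝ) : ℝ := if M < s then 0 else s

lemma hi_meas (M : ℝ) : Measurable (hiPart M) :=
  Measurable.ite measurableSet_Ioi measurable_id measurable_const
lemma lo_meas (M : ℝ) : Measurable (loPart M) :=
  Measurable.ite measurableSet_Ioi measurable_const measurable_id

lemma tail_bd {α : Type*} [MeasurableSpace α] (μ : Measure α) (f : α → ℂ) (hf : Measurable f)
    (p A t : ℝ) (hp : 1 < p) (hA : 0 < A) (ht : 0 < t)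
    (h : ∀ l : ℝ, 0 < l → μ {x | l < ‖f x‖} ≤ ENNReal.ofReal (A ^ p * l ^ (-p))) :
    ∫⁻ x, ENNReal.ofReal (hiPart (A * t ^ (-(1/p))) ‖f x‖) ∂μ
      ≤ ENNReal.ofReal (p/(p-1) * A * t ^ (1 - 1/p)) := by
  set M := A * t ^ (-(1/p)) with hM
  have hM0 : 0 < M := by positivity
  have hp1 : 0 < p - 1 := by linarith
  have hnn : ∀ x, 0 ≤ hiPart M ‖f x‖ := by
    intro x; unfold hiPart; split_ifs <;> simp
  rw [lintegral_eq_lintegral_meas_lt μ (Eventually.of_forall hnn)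
    ((hi_meas M).comp hf.norm).aemeasurable]
  have hsub : ∀ s : ℝ, 0 < s → μ {a | s < hiPart M ‖f a‖} ≤
      ENNReal.ofReal (A ^ p * (max s M) ^ (-p)) := by
    intro s hs
    refine le_trans (measure_mono ?_) (h (max s M) (by positivity))
    intro x hx
    simp only [Set.mem_ofPred_eq, hiPart] at hx ⊢
    split_ifs at hx with h1
    · exact max_lt hx h1
    · linarith
  have hint : IntegrableOn (fun s : ℝ => s ^ (-p)) (Set.Ioi M) :=
    integrableOn_Ioi_rpow_of_lt (by linarith) hM0
  rw [← Set.Ioc_union_Ioi_eq_Ioi hM0.le,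
    lintegral_union measurableSet_Ioi (Set.Ioc_disjoint_Ioi le_rfl)]
  have b1 : ∫⁻ s in Set.Ioc 0 M, μ {a | s < hiPart M ‖f a‖}
      ≤ ENNReal.ofReal (A ^ p * M ^ (-p) * M) := by
    calc _ ≤ ∫⁻ s in Set.Ioc 0 M, ENNReal.ofReal (A ^ p * M ^ (-p)) := by
          refine setLIntegral_mono' measurableSet_Ioc fun s hs => ?_
          have := hsub s hs.1
          rwa [max_eq_right hs.2] at this
      _ = _ := by
          rw [setLIntegral_const, Real.volume_Ioc, sub_zero, ← ENNReal.ofReal_mul (by positivity)]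
  have b2 : ∫⁻ s in Set.Ioi M, μ {a | s < hiPart M ‖f a‖}
      ≤ ENNReal.ofReal (A ^ p * (M ^ (1-p) / (p-1))) := by
    calc _ ≤ ∫⁻ s in Set.Ioi M, ENNReal.ofReal (A ^ p * s ^ (-p)) := by
          refine setLIntegral_mono' measurableSet_Ioi fun s hs => ?_
          have := hsub s (hM0.trans hs)
          rwa [max_eq_left (le_of_lt hs)] at this
      _ = _ := by
          rw [← ofReal_integral_eq_lintegral_ofReal (hint.const_mul _)]
          · rw [integral_const_mul, integral_Ioi_rpow_of_lt (by linarith) hM0]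
            congr 2
            rw [show -p + 1 = -(p-1) by ring, show 1 - p = -(p-1) by ring, div_neg, neg_div, neg_neg]
          · refine (ae_restrict_mem measurableSet_Ioi).mono fun s hs => ?_
            have : 0 < s := hM0.trans hs
            simp only [Pi.zero_apply]; positivity
  refine (add_le_add b1 b2).trans ?_
  rw [← ENNReal.ofReal_add (by positivity) (by positivity)]
  apply ENNReal.ofReal_le_ofReal
  apply le_of_eq
  have e1 : M ^ (-p) * M = M ^ (1 - p) := by
    nth_rewrite 2 [← Real.rpow_one M]
    rw [← Real.rpow_add hM0]; congr 1; ring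
  have e2 : A ^ p * M ^ (1 - p) = A * t ^ (1 - 1/p) := by
    rw [hM, Real.mul_rpow hA.le (by positivity), ← mul_assoc, ← Real.rpow_add hA,
      ← Real.rpow_mul ht.le]
    rw [show p + (1-p) = 1 by ring, Real.rpow_one]
    congr 2; field_simp; ring
  calc A ^ p * M ^ (-p) * M + A ^ p * (M ^ (1-p) / (p-1))
      = (A ^ p * M ^ (1 - p)) * (1 + 1/(p-1)) := by rw [mul_assoc, e1]; ring
    _ = _ := by rw [e2]; field_simp; ring

lemma trunc_bd {α : Type*} [MeasurableSpace α] (μ : Measure α) (f : α → ℂ) (hf : Measurable f)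
    (p a A t : ℝ) (hp : 1 < p) (ha : p < a) (hA : 0 < A) (ht : 0 < t)
    (h : ∀ l : ℝ, 0 < l → μ {x | l < ‖f x‖} ≤ ENNReal.ofReal (A ^ p * l ^ (-p))) :
    (∫⁻ x, ENNReal.ofReal (loPart (A * t ^ (-(1/p))) ‖f x‖) ^ a ∂μ) ^ (1/a)
      ≤ ENNReal.ofReal ((a/(a-p)) ^ (1/a) * A * t ^ (1/a - 1/p)) := by
  set M := A * t ^ (-(1/p)) with hM
  have hM0 : 0 < M := by positivity
  have hap : 0 < a - p := by linarith
  have ha0 : 0 < a := by linarith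
  have hnn : ∀ x, 0 ≤ loPart M ‖f x‖ := by
    intro x; unfold loPart; split_ifs <;> simp
  have key : ∫⁻ x, ENNReal.ofReal (loPart M ‖f x‖) ^ a ∂μ
      ≤ ENNReal.ofReal (a * (A ^ p * (M ^ (a-p) / (a-p)))) := by
    have e0 : ∀ x, ENNReal.ofReal (loPart M ‖f x‖) ^ a = ENNReal.ofReal (loPart M ‖f x‖ ^ a) :=
      fun x => ENNReal.ofReal_rpow_of_nonneg (hnn x) ha0.le
    simp_rw [e0]
    rw [lintegral_rpow_eq_lintegral_meas_lt_mul μ (Eventually.of_forall hnn)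
      ((lo_meas M).comp hf.norm).aemeasurable ha0, ENNReal.ofReal_mul ha0.le]
    gcongr
    rw [← Set.Ioc_union_Ioi_eq_Ioi hM0.le,
      lintegral_union measurableSet_Ioi (Set.Ioc_disjoint_Ioi le_rfl)]
    have b2 : ∫⁻ s in Set.Ioi M, μ {a | s < loPart M ‖f a‖} * ENNReal.ofReal (s ^ (a-1)) = 0 := by
      rw [← nonpos_iff_eq_zero]
      calc _ ≤ ∫⁻ s in Set.Ioi M, (0:ℝ≥0∞) := by
            refine setLIntegral_mono' measurableSet_Ioi fun s hs => ?_
            have : {a | s < loPart M ‖f a‖} = ∅ := by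
              ext x
              simp only [Set.mem_ofPred_eq, Set.mem_empty_iff_false, iff_false, not_lt]
              have : M < s := hs
              unfold loPart; split_ifs <;> linarith
            rw [this]; simp
        _ = 0 := by simp
    rw [b2, add_zero]
    have hint : IntegrableOn (fun s : ℝ => s ^ (a-1-p)) (Set.Ioc 0 M) := by
      have := (intervalIntegral.intervalIntegrable_rpow' (a := 0) (b := M) (r := a-1-p) (by linarith))
      rwa [intervalIntegrable_iff_integrableOn_Ioc_of_le hM0.le] at this
    calc _ ≤ ∫⁻ s in Set.Ioc 0 M, ENNReal.ofReal (A ^ p * s ^ (a-1-p)) := by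
          refine setLIntegral_mono' measurableSet_Ioc fun s hs => ?_
          have hs0 : 0 < s := hs.1
          have h1 : μ {a | s < loPart M ‖f a‖} ≤ ENNReal.ofReal (A ^ p * s ^ (-p)) := by
            refine le_trans (measure_mono ?_) (h s hs0)
            intro x hx
            simp only [Set.mem_ofPred_eq, loPart] at hx ⊢
            split_ifs at hx with h1 <;> linarith
          calc _ ≤ ENNReal.ofReal (A ^ p * s ^ (-p)) * ENNReal.ofReal (s ^ (a-1)) := by gcongr
            _ = _ := by
              rw [← ENNReal.ofReal_mul (by positivity), mul_assoc, ← Real.rpow_add hs0]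
              congr 3; ring
      _ = _ := by
          rw [← ofReal_integral_eq_lintegral_ofReal (hint.const_mul _)]
          · rw [integral_const_mul, ← intervalIntegral.integral_of_le hM0.le,
              integral_rpow (Or.inl (by linarith)), Real.zero_rpow (by linarith)]
            rw [show a - 1 - p + 1 = a - p by ring, sub_zero]
          · refine (ae_restrict_mem measurableSet_Ioc).mono fun s hs => ?_
            have : 0 < s := hs.1
            simp only [Pi.zero_apply]; positivity
  refine (ENNReal.rpow_le_rpow key (by positivity)).trans ?_
  rw [ENNReal.ofReal_rpow_of_nonneg (by positivity) (by positivity)]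
  apply ENNReal.ofReal_le_ofReal
  apply le_of_eq
  have e2 : A ^ p * M ^ (a - p) = A ^ a * t ^ (1 - a/p) := by
    rw [hM, Real.mul_rpow hA.le (by positivity), ← mul_assoc, ← Real.rpow_add hA,
      ← Real.rpow_mul ht.le]
    rw [show p + (a-p) = a by ring]
    congr 2; field_simp; ring
  rw [show a * (A ^ p * (M ^ (a-p) / (a-p))) = (a/(a-p)) * (A ^ p * M ^ (a-p)) by ring, e2,
    Real.mul_rpow (by positivity) (by positivity), Real.mul_rpow (by positivity) (by positivity),
    ← Real.rpow_mul hA.le, ← Real.rpow_mul ht.le, ← mul_assoc]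
  rw [show a * (1/a) = 1 by field_simp, Real.rpow_one]
  congr 2; field_simp

lemma lorentz_congr {α : Type*} [MeasurableSpace α] (μ : Measure α) (p : ℝ) (f f' : α → ℂ)
    (h : f =ᵐ[μ] f') : lorentzNorm μ p ∞ f = lorentzNorm μ p ∞ f' := by
  have hd : distFn μ f = distFn μ f' := by
    funext l
    apply measure_congr
    filter_upwards [h] with x hx
    apply propext
    change l < ENNReal.ofReal ‖f x‖ ↔ l < ENNReal.ofReal ‖f' x‖
    rw [hx]
  simp only [lorentzNorm, rearr, hd]

lemma conv_congr {n : ℕ} (f f' g g' : V n → ℂ) (hf : f =ᵐ[volume] f') (hg : g =ᵐ[volume] g') :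
    conv f g = conv f' g' := by
  funext x
  apply integral_congr_ae
  have := (Measure.measurePreserving_sub_left (volume : Measure (V n)) x).quasiMeasurePreserving.ae_eq_comp hg
  filter_upwards [hf, this] with y h1 h2
  simp only [Function.comp] at h2
  rw [h1, h2]

lemma main_bd (p q r : ℝ) (hp : 1 < p) (hq : 1 < q) (hr : 1 < r)
    (hrel : 1/r = 1/p + 1/q - 1) :
    ∃ C > (0:ℝ), ∀ (n : ℕ) (f g : V n → ℂ), Measurable f → Measurable g →
      ∀ A B : ℝ, 0 < A → 0 < B →
      lorentzNorm volume p ∞ f ≤ ENNReal.ofReal A → lorentzNorm volume q ∞ g ≤ ENNReal.ofReal B →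
      lorentzNorm volume r ∞ (conv f g) ≤ ENNReal.ofReal (C * (A * B)) := by
  have hp0 : 0 < p := by linarith
  have hq0 : 0 < q := by linarith
  have hr0 : 0 < r := by linarith
  have hp1 : 0 < p - 1 := by linarith
  have hq1 : 0 < q - 1 := by linarith
  have ip : 1/p < 1 := by rw [div_lt_one hp0]; exact hp
  have iq : 1/q < 1 := by rw [div_lt_one hq0]; exact hq
  have ir : 0 < 1/r := by positivity
  set u := 1/p - 1/r/2 with hu
  set v := 1/q - 1/r/2 with hv
  have hu0 : 0 < u := by linarith
  have hv0 : 0 < v := by linarith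
  obtain ⟨a, hua, ha0⟩ : ∃ a, u = 1/a ∧ 0 < a := ⟨1/u, by simp, by positivity⟩
  obtain ⟨b, hvb, hb0⟩ : ∃ b, v = 1/b ∧ 0 < b := ⟨1/v, by simp, by positivity⟩
  have hpa : p < a := by
    rw [← one_div_lt_one_div ha0 hp0]; linarith
  have hqb : q < b := by
    rw [← one_div_lt_one_div hb0 hq0]; linarith
  have hap : 0 < a - p := by linarith
  have hbq : 0 < b - q := by linarith
  have hab : a.HolderConjugate b := by
    rw [Real.holderConjugate_iff]
    exact ⟨by linarith, by rw [← one_div, ← one_div]; linarith⟩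
  set Cp := p/(p-1) with hCp
  set Cq := q/(q-1) with hCq
  set Ka := (a/(a-p)) ^ (1/a) with hKa
  set Kb := (b/(b-q)) ^ (1/b) with hKb
  have hCp0 : 0 < Cp := by positivity
  have hCq0 : 0 < Cq := by positivity
  have hKa0 : 0 < Ka := by positivity
  have hKb0 : 0 < Kb := by positivity
  refine ⟨Cp * Cq + (Cp + Cq + Ka * Kb), by positivity, ?_⟩
  intro n f g hf hg A B hA hB hfA hgB
  have df := weak_dist volume f p A hp0 hA hfA
  have dg := weak_dist volume g q B hq0 hB hgB
  rw [lorentzNorm, if_pos rfl]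
  refine iSup_le ?_
  rintro ⟨t, ht⟩
  simp only
  set R := A * B * t ^ (-(1/r)) with hR
  have hR0 : 0 < R := by positivity
  set M := A * t ^ (-(1/p)) with hM
  set N := B * t ^ (-(1/q)) with hN
  set F1 : V n → ℝ≥0∞ := fun x => ENNReal.ofReal (hiPart M ‖f x‖) with hF1
  set F2 : V n → ℝ≥0∞ := fun x => ENNReal.ofReal (loPart M ‖f x‖) with hF2
  set G1 : V n → ℝ≥0∞ := fun x => ENNReal.ofReal (hiPart N ‖g x‖) with hG1
  set G2 : V n → ℝ≥0∞ := fun x => ENNReal.ofReal (loPart N ‖g x‖) with hG2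
  have mF1 : Measurable F1 := ((hi_meas M).comp hf.norm).ennreal_ofReal
  have mF2 : Measurable F2 := ((lo_meas M).comp hf.norm).ennreal_ofReal
  have mG1 : Measurable G1 := ((hi_meas N).comp hg.norm).ennreal_ofReal
  have mG2 : Measurable G2 := ((lo_meas N).comp hg.norm).ennreal_ofReal
  have hFs : ∀ x, ENNReal.ofReal ‖f x‖ = F1 x + F2 x := by
    intro x; simp only [hF1, hF2, hiPart, loPart]; split_ifs <;> simp
  have hGs : ∀ x, ENNReal.ofReal ‖g x‖ = G1 x + G2 x := by
    intro x; simp only [hG1, hG2, hiPart, loPart]; split_ifs <;> simp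
  have hF2M : ∀ x, F2 x ≤ ENNReal.ofReal M := by
    intro x; apply ENNReal.ofReal_le_ofReal; unfold loPart; split_ifs <;> [positivity; linarith]
  have hG2N : ∀ x, G2 x ≤ ENNReal.ofReal N := by
    intro x; apply ENNReal.ofReal_le_ofReal; unfold loPart; split_ifs <;> [positivity; linarith]
  have iF1 : ∫⁻ x, F1 x ≤ ENNReal.ofReal (Cp * A * t ^ (1 - 1/p)) :=
    tail_bd volume f hf p A t hp hA ht df
  have iG1 : ∫⁻ x, G1 x ≤ ENNReal.ofReal (Cq * B * t ^ (1 - 1/q)) :=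
    tail_bd volume g hg q B t hq hB ht dg
  have iF2 : (∫⁻ x, F2 x ^ a) ^ (1/a) ≤ ENNReal.ofReal (Ka * A * t ^ (1/a - 1/p)) :=
    trunc_bd volume f hf p a A t hp hpa hA ht df
  have iG2 : (∫⁻ x, G2 x ^ b) ^ (1/b) ≤ ENNReal.ofReal (Kb * B * t ^ (1/b - 1/q)) :=
    trunc_bd volume g hg q b B t hq hqb hB ht dg
  set H : V n → ℝ≥0∞ := fun x => ∫⁻ y, F1 y * G1 (x - y) with hH
  have mJ : Measurable (Function.uncurry fun x y : V n => F1 y * G1 (x - y)) :=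
    (mF1.comp measurable_snd).mul (mG1.comp (measurable_fst.sub measurable_snd))
  have mH : Measurable H := mJ.lintegral_prod_right'
  have iH : ∫⁻ x, H x ≤ ENNReal.ofReal (Cp * Cq * R * t) := by
    calc ∫⁻ x, H x = ∫⁻ y, ∫⁻ x, F1 y * G1 (x - y) := lintegral_lintegral_swap mJ.aemeasurable
      _ = ∫⁻ y, F1 y * ∫⁻ x, G1 x := by
          congr 1; funext y
          have m : Measurable fun x => G1 (x - y) := mG1.comp (measurable_id.sub_const y)
          rw [lintegral_const_mul _ m,
            lintegral_sub_right_eq_self G1 y]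
      _ = (∫⁻ y, F1 y) * ∫⁻ x, G1 x := lintegral_mul_const _ mF1
      _ ≤ _ := mul_le_mul' iF1 iG1
      _ = _ := by
          rw [← ENNReal.ofReal_mul (by positivity)]
          congr 1
          have : t ^ (1 - 1/p) * t ^ (1 - 1/q) = t ^ (-(1/r)) * t := by
            nth_rewrite 4 [← Real.rpow_one t]
            rw [← Real.rpow_add ht, ← Real.rpow_add ht, hrel]; congr 1; ring
          calc _ = Cp * Cq * A * B * (t ^ (1 - 1/p) * t ^ (1 - 1/q)) := by ring
            _ = _ := by rw [this]; ring
  have b12 : ∀ x, ∫⁻ y, F1 y * G2 (x - y) ≤ ENNReal.ofReal (Cp * R) := by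
    intro x
    calc _ ≤ ∫⁻ y, F1 y * ENNReal.ofReal N := lintegral_mono fun y => by gcongr; exact hG2N _
      _ = (∫⁻ y, F1 y) * ENNReal.ofReal N := lintegral_mul_const _ mF1
      _ ≤ _ := mul_le_mul' iF1 le_rfl
      _ = _ := by
          rw [← ENNReal.ofReal_mul (by positivity)]
          congr 1
          have : t ^ (1 - 1/p) * t ^ (-(1/q)) = t ^ (-(1/r)) := by
            rw [← Real.rpow_add ht, hrel]; congr 1; ring
          rw [hR, ← this, hN]; ring
  have b21 : ∀ x, ∫⁻ y, F2 y * G1 (x - y) ≤ ENNReal.ofReal (Cq * R) := by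
    intro x
    calc _ ≤ ∫⁻ y, ENNReal.ofReal M * G1 (x - y) := lintegral_mono fun y => by gcongr; exact hF2M _
      _ = ENNReal.ofReal M * ∫⁻ y, G1 y := by
          have m : Measurable fun y => G1 (x - y) := mG1.comp (measurable_id.const_sub x)
          rw [lintegral_const_mul _ m,
            lintegral_sub_left_eq_self G1 x]
      _ ≤ _ := mul_le_mul' le_rfl iG1
      _ = _ := by
          rw [← ENNReal.ofReal_mul (by positivity)]
          congr 1
          have : t ^ (-(1/p)) * t ^ (1 - 1/q) = t ^ (-(1/r)) := by
            rw [← Real.rpow_add ht, hrel]; congr 1; ring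
          rw [hR, ← this, hM]; ring
  have b22 : ∀ x, ∫⁻ y, F2 y * G2 (x - y) ≤ ENNReal.ofReal (Ka * Kb * R) := by
    intro x
    have mG2x : Measurable fun y => G2 (x - y) := mG2.comp (measurable_id.const_sub x)
    calc _ ≤ (∫⁻ y, F2 y ^ a) ^ (1/a) * (∫⁻ y, G2 (x - y) ^ b) ^ (1/b) :=
          ENNReal.lintegral_mul_le_Lp_mul_Lq volume hab mF2.aemeasurable mG2x.aemeasurable
      _ = (∫⁻ y, F2 y ^ a) ^ (1/a) * (∫⁻ y, G2 y ^ b) ^ (1/b) := by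
          rw [lintegral_sub_left_eq_self (fun z => G2 z ^ b) x]
      _ ≤ _ := mul_le_mul' iF2 iG2
      _ = _ := by
          rw [← ENNReal.ofReal_mul (by positivity)]
          congr 1
          have : t ^ (1/a - 1/p) * t ^ (1/b - 1/q) = t ^ (-(1/r)) := by
            rw [← Real.rpow_add ht]; congr 1; linarith
          rw [hR, ← this]; ring
  have hconv : ∀ x, ENNReal.ofReal ‖conv f g x‖ ≤
      H x + ENNReal.ofReal ((Cp + Cq + Ka * Kb) * R) := by
    intro x
    have mG1x : Measurable fun y => G1 (x - y) := mG1.comp (measurable_id.const_sub x)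
    have mG2x : Measurable fun y => G2 (x - y) := mG2.comp (measurable_id.const_sub x)
    calc ENNReal.ofReal ‖conv f g x‖ ≤ ∫⁻ y, ENNReal.ofReal ‖f y * g (x - y)‖ := by
          rw [ofReal_norm, conv]
          simp_rw [ofReal_norm]
          exact enorm_integral_le_lintegral_enorm _
      _ = ∫⁻ y, (F1 y * G1 (x - y) + F1 y * G2 (x - y)
            + (F2 y * G1 (x - y) + F2 y * G2 (x - y))) := by
          congr 1; funext y
          rw [norm_mul, ENNReal.ofReal_mul (norm_nonneg _), hFs, hGs]; ring
      _ = (H x + ∫⁻ y, F1 y * G2 (x - y))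
            + ((∫⁻ y, F2 y * G1 (x - y)) + ∫⁻ y, F2 y * G2 (x - y)) := by
          have m11 : Measurable fun y => F1 y * G1 (x - y) := mF1.mul mG1x
          have m12 : Measurable fun y => F1 y * G2 (x - y) := mF1.mul mG2x
          have m21 : Measurable fun y => F2 y * G1 (x - y) := mF2.mul mG1x
          have ms : Measurable fun y => F1 y * G1 (x - y) + F1 y * G2 (x - y) := m11.add m12
          rw [lintegral_add_left ms, lintegral_add_left m11, lintegral_add_left m21]
      _ ≤ (H x + ENNReal.ofReal (Cp * R))
            + (ENNReal.ofReal (Cq * R) + ENNReal.ofReal (Ka * Kb * R)) := by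
          gcongr
          · exact b12 x
          · exact b21 x
          · exact b22 x
      _ = _ := by
          rw [← ENNReal.ofReal_add (by positivity) (by positivity), add_assoc,
            ← ENNReal.ofReal_add (by positivity) (by positivity)]
          congr 2; ring
  have hd : distFn volume (conv f g)
      (ENNReal.ofReal ((Cp * Cq + (Cp + Cq + Ka * Kb)) * R)) ≤ ENNReal.ofReal t := by
    have hpos : 0 < Cp * Cq * R := by positivity
    calc _ ≤ volume {x | ENNReal.ofReal (Cp * Cq * R) ≤ H x} := by
          apply measure_mono
          intro x hx
          simp only [Set.mem_ofPred_eq] at hx ⊢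
          have h1 := hx.trans_le (hconv x)
          rw [add_mul, ENNReal.ofReal_add (by positivity) (by positivity)] at h1
          exact (lt_of_add_lt_add_right h1).le
      _ ≤ (∫⁻ x, H x) / ENNReal.ofReal (Cp * Cq * R) :=
          meas_ge_le_lintegral_div mH.aemeasurable (by simpa using hpos) ENNReal.ofReal_ne_top
      _ ≤ ENNReal.ofReal (Cp * Cq * R * t) / ENNReal.ofReal (Cp * Cq * R) := by gcongr
      _ = _ := by
          rw [← ENNReal.ofReal_div_of_pos hpos]; congr 1; field_simp
  calc ENNReal.ofReal (t ^ (1/r)) * rearr volume (conv f g) (ENNReal.ofReal t)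
      ≤ ENNReal.ofReal (t ^ (1/r)) *
        ENNReal.ofReal ((Cp * Cq + (Cp + Cq + Ka * Kb)) * R) := by
        gcongr; exact sInf_le hd
    _ = _ := by
        rw [← ENNReal.ofReal_mul (by positivity)]
        congr 1
        have : t ^ (1/r) * t ^ (-(1/r)) = 1 := by
          rw [← Real.rpow_add ht]; simp
        calc _ = (Cp * Cq + (Cp + Cq + Ka * Kb)) * (A * B) * (t ^ (1/r) * t ^ (-(1/r))) := by
              rw [hR]; ring
          _ = _ := by rw [this, mul_one]

/-- The weak Young inequality in weak Lebesgue (Marcinkiewicz) spaces. -/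
theorem weak_young (p q r : ℝ) (hp : 1 < p) (hq : 1 < q) (hr : 1 < r)
    (hrel : 1/r = 1/p + 1/q - 1) :
    ∃ C > (0:ℝ), ∀ (n : ℕ) (f g : V n → ℂ),
      AEStronglyMeasurable f volume → AEStronglyMeasurable g volume →
      lorentzNorm volume p ∞ f < ∞ → lorentzNorm volume q ∞ g < ∞ →
      lorentzNorm volume r ∞ (conv f g) < ∞ ∧
      lorentzNorm volume r ∞ (conv f g) ≤
        ENNReal.ofReal C * (lorentzNorm volume p ∞ f * lorentzNorm volume q ∞ g) := by
  obtain ⟨C, hC, H⟩ := main_bd p q r hp hq hr hrel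
  refine ⟨C, hC, ?_⟩
  intro n f g hf hg hfA hgB
  have key : lorentzNorm volume r ∞ (conv f g) ≤
        ENNReal.ofReal C * (lorentzNorm volume p ∞ f * lorentzNorm volume q ∞ g) := by
    set A := (lorentzNorm volume p ∞ f).toReal with hA
    set B := (lorentzNorm volume q ∞ g).toReal with hB
    have eA : lorentzNorm volume p ∞ f = ENNReal.ofReal A := (ENNReal.ofReal_toReal hfA.ne).symm
    have eB : lorentzNorm volume q ∞ g = ENNReal.ofReal B := (ENNReal.ofReal_toReal hgB.ne).symm
    have hA0 : 0 ≤ A := ENNReal.toReal_nonneg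
    have hB0 : 0 ≤ B := ENNReal.toReal_nonneg
    rw [eA, eB, ← ENNReal.ofReal_mul hA0, ← ENNReal.ofReal_mul hC.le]
    have hlim : Tendsto (fun ε : ℝ => ENNReal.ofReal (C * ((A + ε) * (B + ε)))) (𝓝[>] 0)
        (𝓝 (ENNReal.ofReal (C * (A * B)))) := by
      have hc : Continuous (fun ε : ℝ => ENNReal.ofReal (C * ((A + ε) * (B + ε)))) :=
        ENNReal.continuous_ofReal.comp (by fun_prop)
      have := (hc.tendsto 0).mono_left (nhdsWithin_le_nhds (s := Set.Ioi 0))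
      simpa using this
    refine ge_of_tendsto hlim ?_
    filter_upwards [self_mem_nhdsWithin] with ε hε
    have hε0 : 0 < ε := hε
    rw [conv_congr f (hf.mk f) g (hg.mk g) hf.ae_eq_mk hg.ae_eq_mk]
    refine H n _ _ hf.stronglyMeasurable_mk.measurable hg.stronglyMeasurable_mk.measurable
      (A + ε) (B + ε) (by positivity) (by positivity) ?_ ?_
    · rw [← lorentz_congr volume p f _ hf.ae_eq_mk, eA]
      exact ENNReal.ofReal_le_ofReal (by linarith)
    · rw [← lorentz_congr volume q g _ hg.ae_eq_mk, eB]
      exact ENNReal.ofReal_le_ofReal (by linarith)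
  exact ⟨key.trans_lt (ENNReal.mul_lt_top ENNReal.ofReal_lt_top (ENNReal.mul_lt_top hfA hgB)), key⟩

end MHD
end
end
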